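/- arXiv:1911.09065 — 16 statements merged into one kernel-verified Lean document; each statement's English description precedes it below -/
import Mathlib

section
/- Let s ≥ 1 and 1 ≤ g ≤ k. If d = s+1, then every polymorphism f : [d]^m → [d] of (1,g,k)-SetSAT with set size s and domain size d is conservative, i.e., f(x_1,…,x_m) ∈ {x_1,…,x_m} for every input (x_1,…,x_m) ∈ [d]^m. -/
/-- A tuple `a` `g`-satisfies the clause `(S 1, …, S k)` if `a i ∈ S i` for at least `g`
indices `i`. -/
def GSat {d k : ℕ} (g : ℕ) (S : Fin k → Finset (Fin d)) (a : Fin k → Fin d) : Prop :=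
  g ≤ (Finset.univ.filter fun i => a i ∈ S i).card

/-- `f` is a polymorphism of `(1,g,k)`-SetSAT with set size `s` and domain size `d`:
for every clause of width `k` whose literals are sets of size `s`, and all input tuples
(indexed by coordinates `ι`) that each `g`-satisfy the clause, the coordinatewise
application of `f` `1`-satisfies the clause. -/
def IsPolymorphism (d s g k : ℕ) {ι : Type*} (f : (ι → Fin d) → Fin d) : Prop :=
  ∀ S : Fin k → Finset (Fin d), (∀ i, (S i).card = s) →
    ∀ v : ι → Fin k → Fin d, (∀ j, GSat g S (v j)) →
      GSat 1 S fun i => f fun j => v j i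

/-- Every polymorphism of (1,g,k)-SetSAT with set size s and domain size d = s+1
is conservative. -/
theorem stmt0 (s g k m : ℕ) (hs : 1 ≤ s) (hm : 1 ≤ m) (hg : 1 ≤ g) (hgk : g ≤ k)
    (f : (Fin m → Fin (s + 1)) → Fin (s + 1))
    (hf : IsPolymorphism (s + 1) s g k f) :
    ∀ x : Fin m → Fin (s + 1), ∃ j : Fin m, f x = x j := by
  intro x
  by_contra! h
  have := hf (fun _ => Finset.univ.erase (f x)) (by intro i; simp) (fun j _ => x j) (by
    intro j
    have h' : x j ≠ f x := fun e => h j e.symm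
    simpa [GSat, h'] using hgk)
  simp [GSat] at this
end

section
/- Let 1 ≤ s < d and 1 ≤ g ≤ k with (s+1)·g > s·k. Then every plurality function f : [d]^m → [d] (of any arity m ≥ 1) is a polymorphism of (1,g,k)-SetSAT with set size s and domain size d. -/
/-- `f` is symmetric if its value is invariant under permutations of its arguments. -/
def IsSymmetric {d m : ℕ} (f : (Fin m → Fin d) → Fin d) : Prop :=
  ∀ (π : Equiv.Perm (Fin m)) (x : Fin m → Fin d), f (x ∘ π) = f x

/-- `f` is a plurality: a symmetric function whose output attains the maximum number of
occurrences among its arguments. -/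
def IsPlurality {d m : ℕ} (f : (Fin m → Fin d) → Fin d) : Prop :=
  IsSymmetric f ∧ ∀ (x : Fin m → Fin d) (b : Fin d),
    (Finset.univ.filter fun j => x j = b).card ≤
      (Finset.univ.filter fun j => x j = f x).card

/-- If (s+1)·g > s·k then every plurality function is a polymorphism of (1,g,k)-SetSAT
with set size s and domain size d. -/
theorem stmt1 (s d g k m : ℕ) (hs : 1 ≤ s) (hsd : s < d) (hg : 1 ≤ g) (hgk : g ≤ k)
    (hm : 1 ≤ m) (hthr : s * k < (s + 1) * g)
    (f : (Fin m → Fin d) → Fin d) (hf : IsPlurality f) :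
    IsPolymorphism d s g k f := by
  intro S hS v hv
  unfold GSat at hv ⊢
  by_contra hcon
  have h0 : ∀ i, (f fun j => v j i) ∉ S i := by
    intro i hi
    apply hcon
    exact Finset.card_pos.mpr ⟨i, by simpa using hi⟩
  have hcol : ∀ i, (s + 1) * (Finset.univ.filter fun j => v j i ∈ S i).card ≤ s * m := by
    intro i
    have h1 : (Finset.univ.filter fun j => v j i ∈ S i).card
        = ∑ b ∈ S i, (Finset.univ.filter fun j => v j i = b).card := by
      rw [Finset.card_eq_sum_card_fiberwise (f := fun j => v j i) (t := S i)]
      · refine Finset.sum_congr rfl fun b hb => ?_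
        congr 1
        ext j
        simp only [Finset.mem_filter, Finset.mem_univ, true_and]
        constructor
        · exact fun h => h.2
        · exact fun h => ⟨h ▸ hb, h⟩
      · intro j hj
        simpa using hj
    have h2 := Finset.sum_le_card_nsmul (S i)
      (fun b => (Finset.univ.filter fun j => v j i = b).card) _
      (fun b _ => hf.2 (fun j => v j i) b)
    rw [← h1, hS i, smul_eq_mul] at h2
    have h3 : (Finset.univ.filter fun j => v j i ∈ S i).card +
        (Finset.univ.filter fun j => v j i = f fun j => v j i).card ≤ m := by
      rw [← Finset.card_union_of_disjoint]
      · exact (Finset.card_le_univ _).trans (by simp)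
      · rw [Finset.disjoint_filter]
        intro j _ hj he
        exact h0 i (he ▸ hj)
    nlinarith
  have hdc : ∑ j : Fin m, (Finset.univ.filter fun i => v j i ∈ S i).card
      = ∑ i : Fin k, (Finset.univ.filter fun j => v j i ∈ S i).card := by
    simp only [Finset.card_filter]
    exact Finset.sum_comm
  have hlow : m * g ≤ ∑ j : Fin m, (Finset.univ.filter fun i => v j i ∈ S i).card := by
    have := Finset.card_nsmul_le_sum Finset.univ _ g (fun j _ => hv j)
    simpa using this
  have hup : (s + 1) * ∑ i : Fin k, (Finset.univ.filter fun j => v j i ∈ S i).card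
      ≤ k * (s * m) := by
    rw [Finset.mul_sum]
    have := Finset.sum_le_card_nsmul Finset.univ _ (s * m) (fun i _ => hcol i)
    simpa using this
  rw [hdc] at hlow
  have h5 := (Nat.mul_le_mul_left (s + 1) hlow).trans hup
  have h6 := Nat.mul_lt_mul_of_pos_left hthr hm
  nlinarith
end

section
/- Let 1 ≤ s < d and 1 ≤ g ≤ k with (s+1)·g = s·k. Then every plurality function f : [d]^m → [d] whose arity m is not divisible by s+1 is a polymorphism of (1,g,k)-SetSAT with set size s and domain size d. -/
/-- If (s+1)·g = s·k then every plurality function whose arity m is not divisible by s+1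
is a polymorphism of (1,g,k)-SetSAT with set size s and domain size d. -/
theorem stmt2 (s d g k m : ℕ) (hs : 1 ≤ s) (hsd : s < d) (hg : 1 ≤ g) (hgk : g ≤ k)
    (hm : 1 ≤ m) (hthr : (s + 1) * g = s * k) (hnd : ¬ (s + 1) ∣ m)
    (f : (Fin m → Fin d) → Fin d) (hf : IsPlurality f) :
    IsPolymorphism d s g k f := by
  intro S hS v hv
  by_contra hcon
  have hno : ∀ i, f (fun j => v j i) ∉ S i := by
    intro i hi
    apply hcon
    unfold GSat
    exact Finset.card_pos.mpr ⟨i, by simpa using hi⟩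
  have hcol : ∀ i, (s + 1) * (Finset.univ.filter fun j => v j i ∈ S i).card < s * m := by
    intro i
    have h1 : (Finset.univ.filter fun j => v j i ∈ S i).card ≤
        s * (Finset.univ.filter fun j => v j i = f (fun j => v j i)).card := by
      have h := Finset.card_le_mul_card_image_of_maps_to
        (s := Finset.univ.filter fun j => v j i ∈ S i) (t := S i) (f := fun j => v j i)
        (by intro j hj; simpa using hj)
        (Finset.univ.filter fun j => v j i = f (fun j => v j i)).card
        (by
          intro b _
          refine le_trans (Finset.card_le_card ?_) (hf.2 (fun j => v j i) b)
          intro j hj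
          simp at hj ⊢
          exact hj.2)
      rw [hS i] at h
      linarith
    have h2 : (Finset.univ.filter fun j => v j i ∈ S i).card +
        (Finset.univ.filter fun j => v j i = f (fun j => v j i)).card ≤ m := by
      rw [← Finset.card_union_of_disjoint]
      · exact (Finset.card_le_univ _).trans (by simp)
      · rw [Finset.disjoint_left]
        intro j hj hj'
        simp only [Finset.mem_filter, Finset.mem_univ, true_and] at hj hj'
        exact hno i (hj' ▸ hj)
    apply lt_of_le_of_ne
    · nlinarith
    · intro he
      apply hnd
      have : (s + 1) ∣ s * m := ⟨_, he.symm⟩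
      exact Nat.Coprime.dvd_of_dvd_mul_left (by simp) this
  have hdc : ∑ j, (Finset.univ.filter fun i => v j i ∈ S i).card =
      ∑ i, (Finset.univ.filter fun j => v j i ∈ S i).card := by
    simp only [Finset.card_filter]
    exact Finset.sum_comm
  have hlow : m * g ≤ ∑ j, (Finset.univ.filter fun i => v j i ∈ S i).card := by
    have := Finset.card_nsmul_le_sum Finset.univ
      (fun j => (Finset.univ.filter fun i => v j i ∈ S i).card) g (fun j _ => hv j)
    simpa using this
  have hup : ∑ i, (s + 1) * (Finset.univ.filter fun j => v j i ∈ S i).card <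
      ∑ _i : Fin k, s * m :=
    Finset.sum_lt_sum_of_nonempty ⟨⟨0, by omega⟩, Finset.mem_univ _⟩ (fun i _ => hcol i)
  rw [← Finset.mul_sum, ← hdc] at hup
  simp only [Finset.sum_const, Finset.card_univ, Fintype.card_fin, smul_eq_mul] at hup
  have h3 := Nat.mul_le_mul_left (s + 1) hlow
  have h4 : (s + 1) * (m * g) = k * (s * m) := by
    calc (s + 1) * (m * g) = m * ((s + 1) * g) := by ring
      _ = k * (s * m) := by rw [hthr]; ring
  omega
end

section
/- Let s ≥ 1, d = s+1, and 1 ≤ g ≤ k with (s+1)·g = s·k. If m ≥ 1 is divisible by s+1, then no symmetric function f : [d]^m → [d] is a polymorphism of (1,g,k)-SetSAT with set size s and domain size d. -/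
/-- If d = s+1, (s+1)·g = s·k and s+1 divides m, then no symmetric function of arity m is
a polymorphism of (1,g,k)-SetSAT with set size s and domain size s+1. -/
theorem stmt3 (s g k m : ℕ) (hs : 1 ≤ s) (hg : 1 ≤ g) (hgk : g ≤ k)
    (hthr : (s + 1) * g = s * k) (hm : 1 ≤ m) (hdvd : (s + 1) ∣ m)
    (f : (Fin m → Fin (s + 1)) → Fin (s + 1)) (hf : IsSymmetric f) :
    ¬ IsPolymorphism (s + 1) s g k f := by
  intro hp
  have hmz : NeZero m := ⟨by omega⟩
  obtain ⟨t, rfl⟩ : ∃ t, k = (s + 1) * t :=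
    ⟨k - g, by zify [hgk] at hthr ⊢; linarith⟩
  have hgt : g = s * t := by
    have : (s + 1) * g = (s + 1) * (s * t) := by rw [hthr]; ring
    exact Nat.eq_of_mul_eq_mul_left (by omega) this
  let x : Fin m → Fin (s + 1) := fun j => Fin.ofNat (s + 1) j.val
  have h := hp (fun _ => {f x}ᶜ) (fun _ => by simp [Finset.card_compl])
    (fun j i => x (j + Fin.ofNat m i.val)) ?_
  · have h2 : ∀ i : ℕ, f (fun j => x (j + Fin.ofNat m i)) = f x := fun i =>
      hf (Equiv.addRight (Fin.ofNat m i)) x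
    unfold GSat at h
    simp only [h2] at h
    simp at h
  · intro j
    unfold GSat
    have key : ∀ i : ℕ, x (j + Fin.ofNat m i) = f x ↔ i ≡ (f x).val + s * j.val [MOD (s + 1)] := by
      intro i
      have e : (x (j + Fin.ofNat m i)).val = (j.val + i) % (s + 1) := by
        simp [x, Fin.val_add, Nat.mod_mod_of_dvd _ hdvd]
      rw [Fin.ext_iff, e]
      have hb : (f x).val = (f x).val % (s + 1) := (Nat.mod_eq_of_lt (f x).isLt).symm
      generalize (f x).val = b at hb ⊢
      have h0 : (j.val + i) % (s + 1) = b ↔ j.val + i ≡ b [MOD (s + 1)] := by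
        unfold Nat.ModEq; rw [← hb]
      rw [h0]
      have h3 : j.val + (b + s * j.val) ≡ b [MOD (s + 1)] := by
        have : j.val + (b + s * j.val) = b + (s + 1) * j.val := by ring
        rw [this]; simp [Nat.ModEq]
      constructor
      · intro h4
        exact Nat.ModEq.add_left_cancel' j.val (h4.trans h3.symm)
      · intro h4
        exact (Nat.ModEq.add_left j.val h4).trans h3
    have hc : (Finset.univ.filter fun i : Fin ((s + 1) * t) =>
        x (j + Fin.ofNat m i.val) = f x).card = t := by
      simp only [key]
      have := Nat.count_modEq_card ((s + 1) * t) (r := s + 1) (by omega) ((f x).val + s * j.val)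
      rw [Nat.count_eq_card_filter_range] at this
      rw [Finset.card_filter, Finset.sum_range] at this
      rw [Finset.card_filter, this]
      simp
    have hs := Finset.card_filter_add_card_filter_not (s := (Finset.univ : Finset (Fin ((s + 1) * t))))
      (fun i => x (j + Fin.ofNat m i.val) = f x)
    rw [hc] at hs
    simp only [Finset.card_univ, Fintype.card_fin] at hs
    simp only [Finset.mem_compl, Finset.mem_singleton]
    rw [hgt]
    have : (s + 1) * t = s * t + t := by ring
    omega
end

section
/- Let s ≥ 1 and 1 ≤ g < k. A function f : [s+1]^m → [s+1] is a polymorphism of (1,g,k)-SetSAT with set size s and domain size s+1 if and only if there is no multiset S_1,…,S_k of smug sets of f (repetitions allowed) such that each coordinate ℓ ∈ [m] is contained in at most k−g of the sets S_1,…,S_k. -/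
/-- A set `S` of coordinates is a smug set of `f` if there is an input `v` such that the
coordinates agreeing with the output `f v` are exactly those in `S`. -/
def IsSmug {A ι : Type*} (f : (ι → A) → A) (S : Set ι) : Prop :=
  ∃ v : ι → A, S = {i | v i = f v}

theorem aux_gsat {d k : ℕ} (g : ℕ) (hgk : g < k) (c : Fin k → Fin d) (a : Fin k → Fin d) :
    GSat g (fun i => ({c i} : Finset (Fin d))ᶜ) a ↔
      (Finset.univ.filter fun i => a i = c i).card ≤ k - g := by
  unfold GSat
  have h := Finset.card_filter_add_card_filter_not (s := (Finset.univ : Finset (Fin k)))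
    (fun i => a i = c i)
  simp only [Finset.card_univ, Fintype.card_fin] at h
  simp only [Finset.mem_compl, Finset.mem_singleton]
  omega

/-- A function is a polymorphism of (1,g,k)-SetSAT with set size s and domain size s+1
iff there is no multiset of k smug sets covering each coordinate at most k-g times. -/
theorem stmt5 (s m g k : ℕ) (hs : 1 ≤ s) (hm : 1 ≤ m) (hg : 1 ≤ g) (hgk : g < k)
    (f : (Fin m → Fin (s + 1)) → Fin (s + 1)) :
    IsPolymorphism (s + 1) s g k f ↔
      ¬ ∃ T : Fin k → Set (Fin m), (∀ i, IsSmug f (T i)) ∧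
          ∀ l : Fin m, Nat.card {i : Fin k // l ∈ T i} ≤ k - g := by
  classical
  constructor
  · rintro h ⟨T, hT, hl⟩
    choose v hv using hT
    have := h (fun i => ({f (v i)} : Finset (Fin (s + 1)))ᶜ)
      (fun i => by simp [Finset.card_compl]) (fun j i => v i j) (fun j => by
        rw [aux_gsat g hgk]
        have := hl j
        rw [Nat.card_eq_fintype_card, Fintype.card_subtype] at this
        simpa [hv] using this)
    simp [GSat] at this
  · intro h S hS v hv
    have hc : ∀ i, ∃ c, S i = ({c} : Finset (Fin (s + 1)))ᶜ := by
      intro i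
      have : ((S i)ᶜ).card = 1 := by
        rw [Finset.card_compl, hS, Fintype.card_fin]; omega
      obtain ⟨c, hc⟩ := Finset.card_eq_one.mp this
      exact ⟨c, by rw [← hc, compl_compl]⟩
    choose c hc using hc
    obtain rfl : S = fun i => ({c i} : Finset (Fin (s + 1)))ᶜ := funext hc
    by_contra hn
    have hf : ∀ i, f (fun j => v j i) = c i := by
      simpa [GSat, Finset.filter_eq_empty_iff] using hn
    refine h ⟨fun i => {j | v j i = c i}, fun i => ⟨fun j => v j i, by simp [hf]⟩, fun l => ?_⟩
    have := (aux_gsat g hgk c (v l)).1 (hv l)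
    rw [Nat.card_eq_fintype_card, Fintype.card_subtype]
    simpa using this
end

section
/- Let s ≥ 1 and 1 ≤ g < k, and let f : [s+1]^m → [s+1] be a polymorphism of (1,g,k)-SetSAT with set size s and domain size s+1. If S_1,…,S_t are pairwise disjoint smug sets of f, then t·(k−g) < k. -/
/-- A polymorphism of (1,g,k)-SetSAT with set size s and domain size s+1 cannot have t
pairwise disjoint smug sets with t·(k-g) ≥ k. -/
theorem stmt6 (s m g k t : ℕ) (hs : 1 ≤ s) (hm : 1 ≤ m) (hg : 1 ≤ g) (hgk : g < k)
    (f : (Fin m → Fin (s + 1)) → Fin (s + 1)) (hf : IsPolymorphism (s + 1) s g k f)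
    (T : Fin t → Set (Fin m)) (hsmug : ∀ i, IsSmug f (T i))
    (hdisj : Pairwise fun i j => Disjoint (T i) (T j)) :
    t * (k - g) < k := by
  by_contra hcon
  push Not at hcon
  choose v hv using hsmug
  have hr : 0 < k - g := by omega
  have hlt : ∀ i : Fin k, i.val / (k - g) < t := fun i =>
    (Nat.div_lt_iff_lt_mul hr).2 (lt_of_lt_of_le i.isLt hcon)
  let c : Fin k → Fin t := fun i => ⟨i.val / (k - g), hlt i⟩
  have key := hf (fun i => Finset.univ.erase (f (v (c i)))) (fun i => by simp)
    (fun j i => v (c i) j) ?_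
  · simp [GSat] at key
  · intro j
    unfold GSat
    have hmem : ∀ i : Fin k, v (c i) j = f (v (c i)) ↔ j ∈ T (c i) := by
      intro i
      rw [hv (c i)]
      rfl
    have hsplit := Finset.card_filter_add_card_filter_not (s := (Finset.univ : Finset (Fin k)))
      (fun i => v (c i) j = f (v (c i)))
    have hbad : (Finset.univ.filter fun i : Fin k => v (c i) j = f (v (c i))).card ≤ k - g := by
      have hinj : Set.InjOn (fun i : Fin k => i.val % (k - g))
          (Finset.univ.filter fun i : Fin k => v (c i) j = f (v (c i)) : Finset (Fin k)) := by
        intro a ha b hb hab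
        simp only [Finset.coe_filter, Finset.mem_univ, true_and, Set.mem_setOf_eq, hmem] at ha hb
        have hc : c a = c b := by
          by_contra hne
          exact Set.disjoint_left.1 (hdisj hne) ha hb
        have hc' : a.val / (k - g) = b.val / (k - g) := congrArg Fin.val hc
        have hab' : a.val % (k - g) = b.val % (k - g) := hab
        apply Fin.ext
        rw [← Nat.div_add_mod a.val (k - g), ← Nat.div_add_mod b.val (k - g), hc', hab']
      have h := Finset.card_le_card_of_injOn (t := Finset.range (k - g)) _
        (fun a _ => by simpa using Nat.mod_lt _ hr) hinj
      simpa using h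
    simp only [Finset.mem_erase, Finset.mem_univ, and_true, ne_eq]
    simp only [Finset.card_univ, Fintype.card_fin] at hsplit
    omega
end

section
/- Let s ≥ 1 and 1 ≤ g < k, and let f : [s+1]^m → [s+1] be a polymorphism of (1,g,k)-SetSAT with set size s and domain size s+1. Then either f has a smug set of size at most s−1, or there exists a family of s pairwise disjoint minimal smug sets S_1,…,S_s of f. -/
/-- A smug set is minimal if no proper subset of it is a smug set. -/
def IsMinimalSmug {A ι : Type*} (f : (ι → A) → A) (S : Set ι) : Prop :=
  IsSmug f S ∧ ∀ S' : Set ι, S' ⊂ S → ¬ IsSmug f S'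

theorem exists_minimal_smug {m : ℕ} {A : Type*} (f : (Fin m → A) → A) (S : Set (Fin m))
    (h : IsSmug f S) : ∃ M ⊆ S, IsMinimalSmug f M := by
  induction hn : S.ncard using Nat.strong_induction_on generalizing S with
  | _ n ih =>
    by_cases hmin : ∀ S' : Set (Fin m), S' ⊂ S → ¬ IsSmug f S'
    · exact ⟨S, subset_rfl, h, hmin⟩
    · push Not at hmin
      obtain ⟨S', hS', hsm⟩ := hmin
      obtain ⟨M, hM, hMm⟩ := ih S'.ncard (hn ▸ Set.ncard_lt_ncard hS' (Set.toFinite _)) S' hsm rfl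
      exact ⟨M, hM.trans hS'.subset, hMm⟩

open Classical in
theorem smug_step {s m : ℕ} (f : (Fin m → Fin (s + 1)) → Fin (s + 1))
    (hbig : ∀ S : Set (Fin m), IsSmug f S → s - 1 < S.ncard) (t : ℕ) (ht : t < s)
    (T : Fin t → Set (Fin m)) (hT : ∀ i, IsMinimalSmug f (T i))
    (hd : Pairwise fun i j => Disjoint (T i) (T j)) :
    ∃ T : Fin (t + 1) → Set (Fin m), (∀ i, IsMinimalSmug f (T i)) ∧
        Pairwise fun i j => Disjoint (T i) (T j) := by
  have hne : ∀ i, (T i).Nonempty := fun i =>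
    Set.nonempty_of_ncard_ne_zero (by have := hbig _ (hT i).1; omega)
  choose x hx using hne
  let v : Fin m → Fin (s + 1) := fun j =>
    if j ∈ Set.range x then ⟨t, by omega⟩
    else if h : ∃ i, j ∈ T i then ⟨h.choose.val, by have := h.choose.isLt; omega⟩
    else Fin.last s
  have hv1 : ∀ j, j ∈ Set.range x → (v j).val = t := by
    intro j hj
    simp only [v, if_pos hj]
  have hv2 : ∀ j, j ∉ Set.range x → ∀ i, j ∈ T i → (v j).val = i.val := by
    intro j hj i hi
    have h : ∃ i, j ∈ T i := ⟨i, hi⟩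
    have e : h.choose = i := by
      by_contra hc
      exact Set.disjoint_left.1 (hd hc) h.choose_spec hi
    simp only [v, if_neg hj, dif_pos h, e]
  have hv3 : ∀ j, (¬ ∃ i, j ∈ T i) → (v j).val = s := by
    intro j hj
    have hj' : j ∉ Set.range x := by
      rintro ⟨i, rfl⟩
      exact hj ⟨i, hx i⟩
    simp only [v, if_neg hj', dif_neg hj, Fin.val_last]
  have hS : IsSmug f {j | v j = f v} := ⟨v, rfl⟩
  have hlt := (f v).isLt
  rcases lt_trichotomy (f v).val t with hn | hn | hn
  · exfalso
    refine (hT ⟨_, hn⟩).2 _ ?_ hS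
    rw [Set.ssubset_iff_of_subset]
    · refine ⟨x ⟨_, hn⟩, hx _, fun h => ?_⟩
      have h1 := hv1 _ ⟨⟨_, hn⟩, rfl⟩
      have h2 : v (x ⟨_, hn⟩) = f v := h
      rw [h2] at h1
      omega
    · intro j hj
      have hj : v j = f v := hj
      by_cases hr : j ∈ Set.range x
      · have := hv1 j hr
        rw [hj] at this
        omega
      · by_cases he : ∃ i, j ∈ T i
        · obtain ⟨i, hi⟩ := he
          have h2 := hv2 j hr i hi
          rw [hj] at h2
          have : (⟨_, hn⟩ : Fin t) = i := Fin.ext h2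
          rw [this]
          exact hi
        · have := hv3 j he
          rw [hj] at this
          omega
  · exfalso
    have hsub : {j | v j = f v} ⊆ Set.range x := by
      intro j hj
      have hj : v j = f v := hj
      by_contra hr
      by_cases he : ∃ i, j ∈ T i
      · obtain ⟨i, hi⟩ := he
        have h2 := hv2 j hr i hi
        have := i.isLt
        rw [hj] at h2
        omega
      · have := hv3 j he
        rw [hj] at this
        omega
    have h1 := hbig _ hS
    have h2 := Set.ncard_le_ncard hsub (Set.toFinite _)
    have h3 : (Set.range x).ncard ≤ t := by
      rw [← Set.image_univ]
      refine (Set.ncard_image_le (Set.toFinite _)).trans ?_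
      simp [Set.ncard_univ]
    omega
  · obtain ⟨M, hM, hMm⟩ := exists_minimal_smug f _ hS
    have hdis : ∀ i, Disjoint M (T i) := by
      intro i
      rw [Set.disjoint_left]
      intro j hj hi
      have hj : v j = f v := hM hj
      have := i.isLt
      by_cases hr : j ∈ Set.range x
      · have := hv1 j hr
        rw [hj] at this
        omega
      · have h2 := hv2 j hr i hi
        rw [hj] at h2
        omega
    refine ⟨Fin.cons M T, fun i => ?_, fun i j hij => ?_⟩
    · cases i using Fin.cases with
      | zero => simpa using hMm
      | succ i => simpa using hT i
    · cases i using Fin.cases with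
      | zero =>
        cases j using Fin.cases with
        | zero => exact absurd rfl hij
        | succ j => simpa using hdis j
      | succ i =>
        cases j using Fin.cases with
        | zero => simpa using (hdis i).symm
        | succ j => simpa using hd (fun h => hij (by rw [h]))

/-- Every polymorphism of (1,g,k)-SetSAT with set size s and domain size s+1 has a smug
set of size at most s-1, or a family of s pairwise disjoint minimal smug sets. -/
theorem stmt7 (s m g k : ℕ) (hs : 1 ≤ s) (hm : 1 ≤ m) (hg : 1 ≤ g) (hgk : g < k)
    (f : (Fin m → Fin (s + 1)) → Fin (s + 1)) (hf : IsPolymorphism (s + 1) s g k f) :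
    (∃ S : Set (Fin m), IsSmug f S ∧ S.ncard ≤ s - 1) ∨
      (∃ T : Fin s → Set (Fin m), (∀ i, IsMinimalSmug f (T i)) ∧
        Pairwise fun i j => Disjoint (T i) (T j)) := by
  by_cases hbig : ∃ S : Set (Fin m), IsSmug f S ∧ S.ncard ≤ s - 1
  · exact Or.inl hbig
  · right
    push Not at hbig
    have key : ∀ t ≤ s, ∃ T : Fin t → Set (Fin m), (∀ i, IsMinimalSmug f (T i)) ∧
        Pairwise fun i j => Disjoint (T i) (T j) := by
      intro t
      induction t with
      | zero => exact fun _ => ⟨fun _ => ∅, fun i => i.elim0, fun i => i.elim0⟩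
      | succ t ih =>
        intro ht
        obtain ⟨T, hT, hd⟩ := ih (by omega)
        exact smug_step f hbig t (by omega) T hT hd
    exact key s le_rfl
end

section
/- Let s ≥ 1 and 1 ≤ g < k with (s+1)·g < s·k, and let f : [s+1]^m → [s+1] be a polymorphism of (1,g,k)-SetSAT with set size s and domain size s+1. Then f has a smug set of size at most g. -/
open Classical in
theorem key {α : Type*} (F : Finset α → Prop) (N c : ℕ) (hN : 1 ≤ N)
    (hF : ∀ A, F A → N ≤ A.card) (s : ℕ) :
    ∀ (k : ℕ) (X : Finset α), k < c * s → k + 1 ≤ N + c →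
      (∀ h : α → Fin s, ∃ i, F (X.filter fun x => h x = i)) →
      ∃ L : Multiset (Finset α), L.card = k ∧ (∀ A ∈ L, F A ∧ A ⊆ X) ∧
        (∀ x, L.countP (fun A => x ∈ A) ≤ c) ∧
        N + c ≤ ∑ x ∈ X, (c - L.countP (fun A => x ∈ A)) + k + 1 := by
  induction s with
  | zero => intro k X hk; simp at hk
  | succ s ih =>
    intro k X hk hkN hX
    rcases Nat.lt_or_ge k c with hkc | hkc
    · obtain ⟨i, hi⟩ := hX (fun _ => 0)
      set A := X.filter fun x => (0 : Fin (s+1)) = i with hA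
      have hAX : A ⊆ X := Finset.filter_subset _ _
      have hc : ∀ x, (Multiset.replicate k A).countP (fun A => x ∈ A) = if x ∈ A then k else 0 := by
        intro x
        split_ifs with hx
        · rw [Multiset.countP_eq_card.2]
          · simp
          · intro B hB
            rw [Multiset.eq_of_mem_replicate hB]; exact hx
        · rw [Multiset.countP_eq_zero]
          intro B hB
          rw [Multiset.eq_of_mem_replicate hB]; exact hx
      refine ⟨Multiset.replicate k A, by simp, ?_, ?_, ?_⟩
      · intro B hB
        rw [Multiset.eq_of_mem_replicate hB]; exact ⟨hi, hAX⟩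
      · intro x
        rw [hc]; split_ifs <;> omega
      · have h1 : ∑ x ∈ A, (c - k) ≤ ∑ x ∈ X, (c - (Multiset.replicate k A).countP (fun A => x ∈ A)) := by
          calc ∑ x ∈ A, (c - k) ≤ ∑ x ∈ A, (c - (Multiset.replicate k A).countP (fun A => x ∈ A)) := by
                apply Finset.sum_le_sum
                intro x hx
                rw [hc, if_pos hx]
            _ ≤ _ := Finset.sum_le_sum_of_subset hAX
        rw [Finset.sum_const, smul_eq_mul] at h1
        have h2 := hF A hi
        obtain ⟨r, rfl⟩ : ∃ r, c = k + 1 + r := ⟨c - k - 1, by omega⟩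
        have h3 : k + 1 + r - k = r + 1 := by omega
        rw [h3] at h1
        have : N * (r + 1) ≤ A.card * (r + 1) := Nat.mul_le_mul_right _ h2
        have : r ≤ N * r := Nat.le_mul_of_pos_left _ hN
        nlinarith
    · -- minimal Z
      let P : Finset α → Prop := fun Z => ∀ h : α → Fin s, ∃ i, F (Z.filter fun x => h x = i)
      have hPX : P X := by
        intro h
        obtain ⟨i, hi⟩ := hX (fun x => (h x).castSucc)
        refine i.lastCases ?_ ?_ hi
        · intro hi
          exfalso
          have := hF _ hi
          rw [Finset.filter_false_of_mem] at this
          · simp at this; omega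
          · intro x _
            exact (Fin.castSucc_lt_last _).ne
        · intro j hj
          exact ⟨j, by simpa using hj⟩
      obtain ⟨Z, hZm, hZmin⟩ := Finset.exists_min_image (X.powerset.filter P) Finset.card
        ⟨X, by simp [hPX]⟩
      simp only [Finset.mem_filter, Finset.mem_powerset] at hZm hZmin
      obtain ⟨hZX, hPZ⟩ := hZm
      have hB : ∀ z ∈ Z, F (insert z (X \ Z)) := by
        intro z hz
        have hn : ¬ P (Z.erase z) := by
          intro hp
          have := hZmin _ ⟨(Finset.erase_subset _ _).trans hZX, hp⟩
          have := Finset.card_erase_lt_of_mem hz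
          omega
        simp only [P, not_forall, not_exists] at hn
        obtain ⟨h, hh⟩ := hn
        obtain ⟨i, hi⟩ := hX (fun x => if x ∈ Z.erase z then (h x).castSucc else Fin.last s)
        refine i.lastCases ?_ ?_ hi
        · intro hi
          convert hi using 1
          ext x
          by_cases hx : x ∈ Z.erase z
          · have hx' := hx
            rw [Finset.mem_erase] at hx'
            simp only [Finset.mem_filter, if_pos hx, Finset.mem_insert, Finset.mem_sdiff]
            have := (Fin.castSucc_lt_last (h x)).ne
            tauto
          · simp only [Finset.mem_filter, if_neg hx, Finset.mem_insert, Finset.mem_sdiff]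
            rw [Finset.mem_erase] at hx
            constructor
            · rintro (rfl | h)
              · simp [hZX hz]
              · simp [h.1]
            · tauto
        · intro j hj
          exfalso
          apply hh j
          convert hj using 1
          ext x
          by_cases hx : x ∈ Z.erase z
          · have := hZX (Finset.mem_of_mem_erase hx)
            simp only [Finset.mem_filter, if_pos hx, Fin.castSucc_inj]
            tauto
          · have := (Fin.castSucc_lt_last j).ne'
            simp only [Finset.mem_filter, if_neg hx]
            tauto
      obtain ⟨L, hLk, hLF, hLc, hLs⟩ := ih (k - c) Z (by rw [Nat.mul_succ] at hk; omega) (by omega) hPZ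
      set w : α → ℕ := fun x => c - L.countP (fun A => x ∈ A) with hw
      obtain ⟨T, hTle, hTc⟩ : ∃ T ≤ ∑ z ∈ Z, Multiset.replicate (w z) z, T.card = c := by
        have hle : c ≤ (∑ z ∈ Z, Multiset.replicate (w z) z).card := by
          rw [Multiset.card_sum]
          simp only [Multiset.card_replicate]
          change N + c ≤ ∑ x ∈ Z, w x + (k - c) + 1 at hLs
          omega
        have hpos : 0 < (Multiset.powersetCard c (∑ z ∈ Z, Multiset.replicate (w z) z)).card := by
          rw [Multiset.card_powersetCard]
          exact Nat.choose_pos hle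
        obtain ⟨T, hT⟩ := Multiset.card_pos_iff_exists_mem.1 hpos
        exact ⟨T, (Multiset.mem_powersetCard.1 hT).1, (Multiset.mem_powersetCard.1 hT).2⟩
      have hcnt : ∀ x, T.count x ≤ if x ∈ Z then w x else 0 := by
        intro x
        refine (Multiset.count_le_of_le x hTle).trans ?_
        rw [Multiset.count_sum']
        simp [Multiset.count_replicate]
      have hTZ : ∀ x ∈ T, x ∈ Z := by
        intro x hx
        by_contra hxZ
        have := hcnt x
        rw [if_neg hxZ] at this
        have := Multiset.count_pos.2 hx
        omega
      have hLout : ∀ x, x ∉ Z → L.countP (fun A => x ∈ A) = 0 := by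
        intro x hx
        rw [Multiset.countP_eq_zero]
        intro A hA hxA
        exact hx ((hLF A hA).2 hxA)
      have hmap : ∀ x, (T.map fun z => insert z (X \ Z)).countP (fun A => x ∈ A)
          = T.countP (fun z => x ∈ insert z (X \ Z)) := by
        intro x
        rw [Multiset.countP_map, Multiset.countP_eq_card_filter]
      have hmapZ : ∀ x ∈ Z, (T.map fun z => insert z (X \ Z)).countP (fun A => x ∈ A)
          = T.count x := by
        intro x hx
        rw [hmap, Multiset.count]
        apply Multiset.countP_congr rfl
        intro z _
        simp [hx]
      refine ⟨L + T.map fun z => insert z (X \ Z), ?_, ?_, ?_, ?_⟩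
      · simp [hLk, hTc]; omega
      · intro A hA
        rw [Multiset.mem_add, Multiset.mem_map] at hA
        rcases hA with hA | ⟨z, hz, rfl⟩
        · exact ⟨(hLF A hA).1, (hLF A hA).2.trans hZX⟩
        · refine ⟨hB z (hTZ z hz), ?_⟩
          rw [Finset.insert_subset_iff]
          exact ⟨hZX (hTZ z hz), Finset.sdiff_subset⟩
      · intro x
        rw [Multiset.countP_add]
        by_cases hx : x ∈ Z
        · rw [hmapZ x hx]
          have h1 := hcnt x
          rw [if_pos hx] at h1
          have := hLc x
          simp only [hw] at h1
          omega
        · rw [hLout x hx, hmap, zero_add, ← hTc]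
          exact Multiset.countP_le_card _ _
      · have h1 : ∑ x ∈ Z, (w x - T.count x) ≤ ∑ x ∈ X, (c - (L + T.map fun z => insert z (X \ Z)).countP (fun A => x ∈ A)) := by
          refine le_trans (Finset.sum_le_sum ?_) (Finset.sum_le_sum_of_subset hZX)
          intro x hx
          rw [Multiset.countP_add, hmapZ x hx]
          simp only [hw]
          omega
        have h2 : ∑ x ∈ Z, w x = ∑ x ∈ Z, (w x - T.count x) + ∑ x ∈ Z, T.count x := by
          rw [← Finset.sum_add_distrib]
          apply Finset.sum_congr rfl
          intro x hx
          have := hcnt x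
          rw [if_pos hx] at this
          omega
        have h3 : ∑ x ∈ Z, T.count x = c := by
          rw [← hTc]
          exact Multiset.sum_count_eq_card hTZ
        change N + c ≤ ∑ x ∈ Z, w x + (k - c) + 1 at hLs
        omega

/-- If (s+1)·g < s·k then every polymorphism of (1,g,k)-SetSAT with set size s and domain
size s+1 has a smug set of size at most g. -/
theorem stmt8 (s m g k : ℕ) (hs : 1 ≤ s) (hm : 1 ≤ m) (hg : 1 ≤ g) (hgk : g < k)
    (hthr : (s + 1) * g < s * k)
    (f : (Fin m → Fin (s + 1)) → Fin (s + 1)) (hf : IsPolymorphism (s + 1) s g k f) :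
    ∃ S : Set (Fin m), IsSmug f S ∧ S.ncard ≤ g := by
  classical
  by_contra hcon
  push Not at hcon
  obtain ⟨c, rfl⟩ : ∃ c, k = g + c := ⟨k - g, by omega⟩
  obtain ⟨L, hLk, hLF, hLc, -⟩ := key (fun A : Finset (Fin m) => IsSmug f (A : Set (Fin m)))
    (g + 1) c (by omega)
    (by
      intro A hA
      have := hcon _ hA
      rw [Set.ncard_coe_finset] at this
      omega) (s + 1) (g + c) Finset.univ (by nlinarith) (by omega)
    (by
      intro h
      exact ⟨f h, h, by ext; simp⟩)
  obtain ⟨l, rfl⟩ := Quot.exists_rep L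
  have hl : l.length = g + c := hLk
  obtain ⟨A, hA⟩ : ∃ A : Fin (g + c) → Finset (Fin m), List.ofFn A = l := by
    rw [← hl]; exact ⟨l.get, List.ofFn_get l⟩
  subst hA
  have hsm : ∀ i, ∃ v : Fin m → Fin (s + 1), (A i : Set (Fin m)) = {j | v j = f v} := by
    intro i
    exact (hLF (A i) (by
      show A i ∈ List.ofFn A
      simp [List.mem_ofFn])).1
  choose v hv using hsm
  have hv' : ∀ i j, j ∈ A i ↔ v i j = f (v i) := by
    intro i j
    rw [← Finset.mem_coe, hv]; rfl
  have h := hf (fun i => {f (v i)}ᶜ) (by intro i; simp [Finset.card_compl]) (fun j i => v i j) (by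
    intro j
    unfold GSat
    have h1 : (Multiset.countP (fun B => j ∈ B) ((List.ofFn A : List _) : Multiset (Finset (Fin m)))) ≤ c := by
      have h0 := hLc j
      rw [Multiset.quot_mk_to_coe''] at h0
      convert h0
    rw [← Fin.univ_val_map, Multiset.countP_map] at h1
    have h2 : (Finset.univ.filter fun i => j ∈ A i).card ≤ c := h1
    have h3 := Finset.card_filter_add_card_filter_not (s := (Finset.univ : Finset (Fin (g + c)))) (fun i => j ∈ A i)
    have h4 : (Finset.univ.filter fun i => v i j ∈ ({f (v i)}ᶜ : Finset (Fin (s+1)))) = Finset.univ.filter fun i => ¬ j ∈ A i := by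
      ext i; simp [hv']
    rw [h4]
    simp only [Finset.card_univ, Fintype.card_fin] at h3
    omega)
  unfold GSat at h
  simp at h
end

section
/- Let s ≥ 1, 1 ≤ g ≤ k, let U be a finite nonempty set, and let 𝒮 = (S_1,…,S_N) be a sequence of nonempty subsets of U such that: (a) for every function x : U → [s+1] there exist a ∈ [s+1] and j ∈ [N] with {u ∈ U : x(u) = a} = S_j; and (b) for every k-tuple (S_{i_1},…,S_{i_k}) of sets from the sequence (repetitions allowed), some u ∈ U is contained in at least k−g+1 of the k sets. Define q_𝒮 : [s+1]^U → [s+1] by q_𝒮(x) = a, where j is the least index in [N] such that {u ∈ U : x(u) = a'} = S_j for some a' ∈ [s+1], and a is the (unique) value with {u ∈ U : x(u) = a} = S_j. Then q_𝒮 is a well-defined polymorphism of (1,g,k)-SetSAT with set size s and domain size s+1, and every smug set of q_𝒮 belongs to {S_1,…,S_N}. -/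
/-- The defining property of the function q associated to the sequence of sets S:
on input x, the level set of the output value of q is the earliest member of the sequence
that occurs as a level set of x. -/
def QSpec {s N : ℕ} {U : Type*} (S : Fin N → Set U)
    (q : (U → Fin (s + 1)) → Fin (s + 1)) : Prop :=
  ∀ x : U → Fin (s + 1), ∃ j : Fin N,
    {u | x u = q x} = S j ∧
      ∀ j' : Fin N, (∃ a : Fin (s + 1), {u | x u = a} = S j') → j ≤ j'

/-- Given a sequence of nonempty subsets of a finite set U such that (a) every input has
some level set in the sequence, and (b) every k-tuple of sets from the sequence has a point
covered at least k-g+1 times, the function q defined by choosing the earliest level set is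
well-defined (exists and is unique), is a polymorphism of (1,g,k)-SetSAT with set size s
and domain size s+1, and all its smug sets belong to the sequence. -/
theorem stmt9 (s g k N : ℕ) (hs : 1 ≤ s) (hg : 1 ≤ g) (hgk : g ≤ k)
    {U : Type*} [Fintype U] [Nonempty U]
    (S : Fin N → Set U) (hne : ∀ j, (S j).Nonempty)
    (ha : ∀ x : U → Fin (s + 1), ∃ (a : Fin (s + 1)) (j : Fin N), {u | x u = a} = S j)
    (hb : ∀ idx : Fin k → Fin N, ∃ u : U,
      k - g + 1 ≤ Nat.card {i : Fin k // u ∈ S (idx i)}) :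
    ∃ q : (U → Fin (s + 1)) → Fin (s + 1),
      QSpec S q ∧ (∀ q' : (U → Fin (s + 1)) → Fin (s + 1), QSpec S q' → q' = q) ∧
        IsPolymorphism (s + 1) s g k q ∧
        ∀ T : Set U, IsSmug q T → ∃ j : Fin N, T = S j := by
  classical
  have hex : ∀ x : U → Fin (s + 1), ∃ a : Fin (s + 1), ∃ j : Fin N,
      {u | x u = a} = S j ∧
        ∀ j' : Fin N, (∃ a : Fin (s + 1), {u | x u = a} = S j') → j ≤ j' := by
    intro x
    let J : Finset (Fin N) := Finset.univ.filter fun j => ∃ a : Fin (s + 1), {u | x u = a} = S j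
    have hJ : J.Nonempty := by
      obtain ⟨a, j, h⟩ := ha x
      exact ⟨j, by simp only [J, Finset.mem_filter, Finset.mem_univ, true_and]; exact ⟨a, h⟩⟩
    have hm := J.min'_mem hJ
    obtain ⟨a, h⟩ := (Finset.mem_filter.1 hm).2
    exact ⟨a, J.min' hJ, h, fun j' hj' =>
      J.min'_le j' (Finset.mem_filter.2 ⟨Finset.mem_univ _, hj'⟩)⟩
  choose q hq using hex
  have hqs : QSpec S q := hq
  refine ⟨q, hqs, ?_, ?_, ?_⟩
  · intro q' hq'
    funext x
    obtain ⟨j, h1, h2⟩ := hqs x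
    obtain ⟨j', h1', h2'⟩ := hq' x
    have hj : j = j' := le_antisymm (h2 j' ⟨_, h1'⟩) (h2' j ⟨_, h1⟩)
    subst hj
    obtain ⟨u, hu⟩ := hne j
    have e1 : x u = q x := by rw [← h1] at hu; exact hu
    have e2 : x u = q' x := by rw [← h1'] at hu; exact hu
    exact e2.symm.trans e1
  · intro C hC v hv
    by_contra hcon
    have hno : ∀ i, q (fun j => v j i) ∉ C i := by
      intro i hi
      apply hcon
      exact Finset.card_pos.2 ⟨i, Finset.mem_filter.2 ⟨Finset.mem_univ _, hi⟩⟩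
    choose idx hidx _ using fun i => hqs (fun j => v j i)
    obtain ⟨u, hu⟩ := hb idx
    have h1 : g ≤ (Finset.univ.filter fun i => v u i ∈ C i).card := hv u
    rw [Nat.card_eq_fintype_card, Fintype.card_subtype] at hu
    have hd : Disjoint (Finset.univ.filter fun i => v u i ∈ C i)
        (Finset.univ.filter fun i => u ∈ S (idx i)) := by
      rw [Finset.disjoint_left]
      intro i hi hi'
      have a1 := (Finset.mem_filter.1 hi).2
      have a2 := (Finset.mem_filter.1 hi').2
      rw [← hidx i] at a2
      have a3 : v u i = q (fun j => v j i) := a2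
      exact hno i (a3 ▸ a1)
    have h3 := Finset.card_le_univ ((Finset.univ.filter fun i => v u i ∈ C i) ∪
        (Finset.univ.filter fun i => u ∈ S (idx i)))
    rw [Finset.card_union_of_disjoint hd, Fintype.card_fin] at h3
    omega
  · rintro T ⟨x, rfl⟩
    obtain ⟨j, h, _⟩ := hqs x
    exact ⟨j, h⟩
end

section
/- Let s ≥ 1, m ≥ 4, g ≥ 3, and k = g+2 (so that k−g+1 = 3 and g/k > 1/2). Then the function q_m : [s+1]^U → [s+1] is a polymorphism of (1,g,k)-SetSAT with set size s and domain size s+1, of arity |U| = C(m,3)+1. -/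
/-- The coordinate set U: all 3-element subsets of [m] together with one extra element ⊥
(represented by `none`). -/
abbrev Um (m : ℕ) := Option {T : Finset (Fin m) // T.card = 3}

/-- For i ∈ [m], the set of coordinates given by the triples containing i. -/
def SmCoord (m : ℕ) (i : Fin m) : Set (Um m) :=
  {u | ∃ T : {T : Finset (Fin m) // T.card = 3}, u = some T ∧ i ∈ T.val}

/-- The defining property of q_m: on input x, if all coordinates in some S_i carry the same
value a, then the output is a; otherwise the output is the value at ⊥. -/
def IsQm (m s : ℕ) (q : (Um m → Fin (s + 1)) → Fin (s + 1)) : Prop :=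
  ∀ x : Um m → Fin (s + 1),
    (∀ (i : Fin m) (a : Fin (s + 1)), (∀ u ∈ SmCoord m i, x u = a) → q x = a) ∧
      ((¬ ∃ (i : Fin m) (a : Fin (s + 1)), ∀ u ∈ SmCoord m i, x u = a) → q x = x none)

/-- For m ≥ 4, g ≥ 3 and k = g+2, the function q_m is a polymorphism of (1,g,k)-SetSAT
with set size s and domain size s+1, of arity C(m,3)+1. -/
theorem stmt10 (s m g k : ℕ) (hs : 1 ≤ s) (hm : 4 ≤ m) (hg : 3 ≤ g) (hk : k = g + 2)
    (q : (Um m → Fin (s + 1)) → Fin (s + 1)) (hq : IsQm m s q) :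
    IsPolymorphism (s + 1) s g k q ∧ Fintype.card (Um m) = Nat.choose m 3 + 1 := by
  constructor
  · intro S _ v hv
    unfold GSat at hv ⊢
    by_contra hcon
    have hfail : ∀ i, q (fun j => v j i) ∉ S i := by
      intro i hi
      apply hcon
      exact Finset.card_pos.mpr ⟨i, by simpa using hi⟩
    obtain ⟨A, hA, hAc⟩ := Finset.exists_subset_card_eq (hg.trans (hv none))
    have hw : ∀ i : Fin k, ∃ j : Fin m, i ∈ A → ∀ u ∈ SmCoord m j, v u i ∉ S i := by
      intro i
      by_cases hi : i ∈ A
      · by_cases h : ∃ (j : Fin m) (a : Fin (s + 1)), ∀ u ∈ SmCoord m j, v u i = a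
        · obtain ⟨j, a, h⟩ := h
          refine ⟨j, fun _ u hu => ?_⟩
          have h1 := (hq (fun j => v j i)).1 j a h
          rw [h u hu, ← h1]
          exact hfail i
        · have h1 := (hq (fun j => v j i)).2 h
          have h2 := (Finset.mem_filter.mp (hA hi)).2
          exact absurd (h1 ▸ h2) (hfail i)
      · exact ⟨⟨0, by omega⟩, fun h => absurd h hi⟩
    choose j hj using hw
    obtain ⟨T, hT, hTc⟩ := Finset.exists_superset_card_eq (s := A.image j) (n := 3)
      (Finset.card_image_le.trans hAc.le) (by simp; omega)
    have hd : Disjoint A (Finset.univ.filter fun i => v (some ⟨T, hTc⟩) i ∈ S i) := by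
      rw [Finset.disjoint_left]
      intro i hi h
      exact hj i hi (some ⟨T, hTc⟩) ⟨_, rfl, hT (Finset.mem_image_of_mem j hi)⟩
        (Finset.mem_filter.mp h).2
    have h1 := Finset.card_le_univ
      (A ∪ (Finset.univ.filter fun i => v (some ⟨T, hTc⟩) i ∈ S i))
    rw [Finset.card_union_of_disjoint hd, Fintype.card_fin] at h1
    have h2 := hv (some ⟨T, hTc⟩)
    omega
  · simp [Um, Fintype.card_option, Fintype.card_finset_len]
end

section
/- Let s ≥ 1 and m ≥ 4, and for i ∈ [m] define π_i : U → [m+1] by π_i(T) = m+1 if T is a 3-element subset of [m] containing i, and π_i(u) = i otherwise (in particular π_i(⊥) = i). Then: (a) for every i ∈ [m] and every x ∈ [s+1]^{m+1}, q_m applied to the input (x_{π_i(u)})_{u ∈ U} equals x_{m+1} (i.e., the minor of q_m given by π_i is the projection to coordinate m+1); and (b) for every u ∈ U and every j ∈ [m+1], the set {i ∈ [m] : π_i(u) = j} has at most 3 elements, so no assignment of projections to the two symbols satisfies more than 3 of the m minor identities q_m →^{π_i} p. -/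
/-- The map π_i sending each triple containing i to the last coordinate m+1 and every other
coordinate (including ⊥) to i. -/
def piQm (m : ℕ) (i : Fin m) : Um m → Fin (m + 1) :=
  fun u => match u with
    | none => i.castSucc
    | some T => if i ∈ T.val then Fin.last m else i.castSucc

/-- (a) Each minor of q_m given by π_i is the projection to the last coordinate;
(b) for any coordinate u of q_m and any coordinate j of the projection, at most 3 of the
maps π_i send u to j, hence no assignment of projections to the two symbols satisfies more
than 3 of the m minor identities. -/
theorem stmt11 (s m : ℕ) (hs : 1 ≤ s) (hm : 4 ≤ m)
    (q : (Um m → Fin (s + 1)) → Fin (s + 1)) (hq : IsQm m s q) :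
    (∀ (i : Fin m) (x : Fin (m + 1) → Fin (s + 1)),
        q (fun u => x (piQm m i u)) = x (Fin.last m)) ∧
      ∀ (u : Um m) (j : Fin (m + 1)), Nat.card {i : Fin m // piQm m i u = j} ≤ 3 := by
  refine ⟨fun i x => ?_, fun u j => ?_⟩
  · refine (hq _).1 i _ ?_
    rintro u ⟨T, rfl, hT⟩
    simp [piQm, hT]
  · have key : ∃ F : Finset (Fin m), F.card ≤ 3 ∧ ∀ i, piQm m i u = j → i ∈ F := by
      by_cases hj : j = Fin.last m
      · subst hj
        cases u with
        | none =>
          exact ⟨∅, by simp, fun i hi => absurd hi (Fin.castSucc_lt_last i).ne⟩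
        | some T =>
          refine ⟨T.1, T.2.le, fun i hi => ?_⟩
          by_contra h
          simp only [piQm, h, if_false] at hi
          exact (Fin.castSucc_lt_last i).ne hi
      · obtain ⟨k, rfl⟩ := Fin.exists_castSucc_eq.2 hj
        refine ⟨{k}, by simp, fun i hi => ?_⟩
        rw [Finset.mem_singleton]
        cases u with
        | none => exact Fin.castSucc_injective m hi
        | some T =>
          by_cases h : i ∈ T.1
          · simp only [piQm, h, if_true] at hi
            exact absurd hi.symm hj
          · simp only [piQm, h, if_false] at hi
            exact Fin.castSucc_injective m hi
    obtain ⟨F, hF, h⟩ := key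
    refine le_trans ?_ hF
    have hc : Nat.card (F : Set (Fin m)) = F.card := by simp
    rw [← hc]
    exact Nat.card_le_card_of_injective (fun i => (⟨i.1, h i.1 i.2⟩ : (F : Set (Fin m))))
      (fun a b hab => Subtype.ext (by simpa using hab))
end

section
/- Let s ≥ 1 and m ≥ 4. For every subset W ⊆ U with 3·|W| < m, every partial assignment y : W → [s+1], and every value a ∈ [s+1], there exists x ∈ [s+1]^U with x_u = y(u) for all u ∈ W and q_m(x) = a. -/
/-- Any partial assignment to fewer than m/3 coordinates of q_m can be extended to a full
input on which q_m takes any prescribed value. -/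
theorem stmt12 (s m : ℕ) (hs : 1 ≤ s) (hm : 4 ≤ m)
    (q : (Um m → Fin (s + 1)) → Fin (s + 1)) (hq : IsQm m s q)
    (W : Finset (Um m)) (hW : 3 * W.card < m)
    (y : Um m → Fin (s + 1)) (a : Fin (s + 1)) :
    ∃ x : Um m → Fin (s + 1), (∀ u ∈ W, x u = y u) ∧ q x = a := by
  classical
  let f : Um m → Finset (Fin m) := fun u => u.elim ∅ (fun T => T.val)
  have hf : ∀ u ∈ W, (f u).card ≤ 3 := by
    intro u _
    rcases u with _ | T
    · simp [f]
    · exact T.2.le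
  have hc : (W.biUnion f).card < m := by
    have := Finset.card_biUnion_le_card_mul W f 3 hf
    omega
  obtain ⟨i, hi⟩ : ∃ i, i ∉ W.biUnion f := by
    by_contra! h
    have h2 : W.biUnion f = Finset.univ := Finset.eq_univ_iff_forall.mpr h
    rw [h2] at hc
    simp at hc
  refine ⟨fun u => if u ∈ W then y u else a, fun u hu => by simp [hu], ?_⟩
  refine (hq _).1 i a ?_
  rintro u ⟨T, rfl, hT⟩
  have : (some T : Um m) ∉ W := fun h => hi (Finset.mem_biUnion.mpr ⟨some T, h, hT⟩)
  simp [this]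
end

section
/- Let s ≥ 1 and m ≥ 4, and let T ⊆ U be a set with ⊥ ∈ T and T ∩ S_i ≠ ∅ for every i ∈ [m]. Then for every x ∈ [s+1]^U that is constant on T, say with value c on T, one has q_m(x) = c. (Consequently, the minor of q_m obtained by identifying all coordinates in T is the projection to the resulting coordinate.) -/
/-- If T contains ⊥ and intersects every S_i, then q_m of any input constant on T equals
that constant value; hence identifying all coordinates in T yields a projection. -/
theorem stmt13 (s m : ℕ) (hs : 1 ≤ s) (hm : 4 ≤ m)
    (q : (Um m → Fin (s + 1)) → Fin (s + 1)) (hq : IsQm m s q)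
    (T : Set (Um m)) (hbot : none ∈ T) (hmeet : ∀ i : Fin m, (T ∩ SmCoord m i).Nonempty)
    (x : Um m → Fin (s + 1)) (c : Fin (s + 1)) (hconst : ∀ u ∈ T, x u = c) :
    q x = c := by
  by_cases h : ∃ (i : Fin m) (a : Fin (s + 1)), ∀ u ∈ SmCoord m i, x u = a
  · obtain ⟨i, a, h⟩ := h
    obtain ⟨u, huT, huS⟩ := hmeet i
    rw [(hq x).1 i a h, ← h u huS, hconst u huT]
  · rw [(hq x).2 h, hconst none hbot]
end

section
/- Let s ≥ 1 and 1 ≤ g ≤ k with 2g > k. Then there exists a function o : [s+1]^6 → [s+1] that is both a polymorphism of (1,g,k)-SetSAT with set size s and domain size s+1 and an Olšák function, i.e., o(x,x,y,y,y,x) = o(x,y,x,y,x,y) = o(y,x,x,x,y,y) for all x,y ∈ [s+1]. -/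
/-- If 2g > k then (1,g,k)-SetSAT with set size s and domain size s+1 has a polymorphism
that is an Olšák function. -/
theorem stmt14 (s g k : ℕ) (hs : 1 ≤ s) (hg : 1 ≤ g) (hgk : g ≤ k) (h2g : k < 2 * g) :
    ∃ o : (Fin 6 → Fin (s + 1)) → Fin (s + 1),
      IsPolymorphism (s + 1) s g k o ∧
        ∀ x y : Fin (s + 1),
          o ![x, x, y, y, y, x] = o ![x, y, x, y, x, y] ∧
            o ![x, y, x, y, x, y] = o ![y, x, x, x, y, y] := by
  refine ⟨fun u => if u 1 = u 2 ∧ u 2 = u 3 then u 1 else u 0, ?_, ?_⟩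
  · intro S _ v hv
    have h0 := hv 0
    have h1 := hv 1
    unfold GSat at h0 h1 ⊢
    have hc := Finset.card_union_add_card_inter
      (Finset.univ.filter fun i => v 0 i ∈ S i) (Finset.univ.filter fun i => v 1 i ∈ S i)
    have hu := Finset.card_le_univ
      ((Finset.univ.filter fun i => v 0 i ∈ S i) ∪ (Finset.univ.filter fun i => v 1 i ∈ S i))
    rw [Fintype.card_fin] at hu
    have hpos : 0 < ((Finset.univ.filter fun i => v 0 i ∈ S i) ∩
      (Finset.univ.filter fun i => v 1 i ∈ S i)).card := by omega
    obtain ⟨i, hi⟩ := Finset.card_pos.mp hpos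
    simp only [Finset.mem_inter, Finset.mem_filter, Finset.mem_univ, true_and] at hi
    refine Finset.card_pos.mpr ⟨i, ?_⟩
    simp only [Finset.mem_filter, Finset.mem_univ, true_and]
    split_ifs
    · exact hi.2
    · exact hi.1
  · intro x y
    by_cases h : x = y
    · subst h; simp
    · have h' : ¬ y = x := fun e => h e.symm
      simp [h, h']
end

section
/- Let s ≥ 1 and 1 ≤ g ≤ k with 2g > k. Then there exists a function f : [s+1]^6 → [s+1] that is both a polymorphism of (1,g,k)-SetSAT with set size s and domain size s+1 and a Siggers function, i.e., f(x,y,x,z,y,z) = f(y,x,z,x,z,y) for all x,y,z ∈ [s+1]. -/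
/-- If 2g > k then (1,g,k)-SetSAT with set size s and domain size s+1 has a polymorphism
that is a Siggers function. -/
theorem stmt15 (s g k : ℕ) (hs : 1 ≤ s) (hg : 1 ≤ g) (hgk : g ≤ k) (h2g : k < 2 * g) :
    ∃ f : (Fin 6 → Fin (s + 1)) → Fin (s + 1),
      IsPolymorphism (s + 1) s g k f ∧
        ∀ x y z : Fin (s + 1), f ![x, y, x, z, y, z] = f ![y, x, z, x, z, y] := by
  classical
  refine ⟨fun t => if t 0 = t 2 ∧ t 1 = t 4 ∧ t 3 = t 5 then t 0 else t 1, ?_, ?_⟩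
  · intro S _ v hv
    have h0 := hv 0
    have h1 := hv 1
    unfold GSat at h0 h1 ⊢
    have hne : ((Finset.univ.filter fun i => v 0 i ∈ S i) ∩
        (Finset.univ.filter fun i => v 1 i ∈ S i)).Nonempty := by
      rw [← Finset.card_pos]
      have e := Finset.card_union_add_card_inter (Finset.univ.filter fun i => v 0 i ∈ S i)
        (Finset.univ.filter fun i => v 1 i ∈ S i)
      have u := Finset.card_le_univ ((Finset.univ.filter fun i => v 0 i ∈ S i) ∪
        (Finset.univ.filter fun i => v 1 i ∈ S i))
      rw [Fintype.card_fin] at u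
      omega
    obtain ⟨i, hi⟩ := hne
    simp only [Finset.mem_inter, Finset.mem_filter, Finset.mem_univ, true_and] at hi
    refine Finset.card_pos.mpr ⟨i, ?_⟩
    simp only [Finset.mem_filter, Finset.mem_univ, true_and]
    split_ifs
    · exact hi.1
    · exact hi.2
  · intro x y z
    change (if x = x ∧ y = y ∧ z = z then x else y) = (if y = z ∧ x = z ∧ x = y then y else x)
    grind
end

section
/- Let A, B be sets and let M be a minion on (A,B) such that every function in M has at least one essential coordinate, and every function in M of arity at most m has essential arity at most F, for some integer F ≥ 1. Suppose a bipartite minor condition Σ, involving only symbols of arity at most m, is satisfied in M. Then Σ is not (1/F)-robust: there exists an assignment of projections to the symbols of Σ that simultaneously satisfies at least a 1/F fraction of the identities of Σ. -/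
/-- The i-th coordinate of f is essential if changing only that coordinate can change the
value of f. -/
def EssentialCoord {A B : Type*} {n : ℕ} (f : (Fin n → A) → B) (i : Fin n) : Prop :=
  ∃ (x : Fin n → A) (a : A), f (Function.update x i a) ≠ f x

/-- A minion on (A, B): a nonempty family of finitary functions closed under minors. -/
structure Minion (A B : Type*) where
  carrier : ∀ n : ℕ, Set ((Fin n → A) → B)
  carrier_nonempty : ∃ (n : ℕ) (f : (Fin n → A) → B), f ∈ carrier n
  minor_closed : ∀ {n m : ℕ} (f : (Fin n → A) → B) (π : Fin n → Fin m),
    f ∈ carrier n → (fun x => f (x ∘ π)) ∈ carrier m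

theorem eq_of_inessential {A B : Type*} {n : ℕ} (f : (Fin n → A) → B) (T : Finset (Fin n)) :
    (∀ j ∈ T, ¬ EssentialCoord f j) → ∀ x y : Fin n → A, (∀ j, j ∉ T → x j = y j) → f x = f y := by
  classical
  induction T using Finset.induction_on with
  | empty =>
    intro _ x y h
    have : x = y := funext fun j => h j (by simp)
    rw [this]
  | insert a T ha ih =>
    intro hT x y h
    have h1 : f (Function.update x a (y a)) = f x := by
      by_contra hne
      exact hT a (by simp) ⟨x, y a, hne⟩
    rw [← h1]
    apply ih (fun j hj => hT j (by simp [hj]))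
    intro j hj
    by_cases hja : j = a
    · subst hja; simp
    · rw [Function.update_of_ne hja]
      exact h j (by simp [hja, hj])

theorem exists_essential_preimage {A B : Type*} {n k : ℕ} (f : (Fin n → A) → B)
    (g : (Fin k → A) → B) (π : Fin n → Fin k) (hg : ∀ x, g x = f (x ∘ π)) (i : Fin k)
    (hi : EssentialCoord g i) : ∃ j, EssentialCoord f j ∧ π j = i := by
  classical
  by_contra hcon
  push Not at hcon
  obtain ⟨x, a, hne⟩ := hi
  apply hne
  rw [hg, hg]
  apply eq_of_inessential f (Finset.univ.filter fun j => π j = i)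
  · intro j hj hess
    exact hcon j hess (by simpa using hj)
  · intro j hj
    have : π j ≠ i := by simpa using hj
    simp [Function.update_of_ne this]

/-- A minion M where every function has at least one essential coordinate and every
function of arity at most m has essential arity at most F cannot satisfy any (1/F)-robust
bipartite minor condition with symbols of arity at most m: if the condition (given by
symbol sets indexed by iU, iV with arities arU, arV, and identities indexed by iE, where
identity e relates the V-symbol eV e to the U-symbol eU e via the map ep e) is satisfied
in M, then some assignment of projections to the symbols simultaneously satisfies at
least a 1/F fraction of the identities. -/
theorem stmt17 {A B : Type*} (M : Minion A B) (m F : ℕ) (hF : 1 ≤ F)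
    (hess : ∀ (n : ℕ) (f : (Fin n → A) → B), f ∈ M.carrier n →
      ∃ i : Fin n, EssentialCoord f i)
    (hbound : ∀ n : ℕ, n ≤ m → ∀ f ∈ M.carrier n,
      Nat.card {i : Fin n // EssentialCoord f i} ≤ F)
    {iU iV iE : Type*} [Fintype iE]
    (arU : iU → ℕ) (arV : iV → ℕ)
    (harU : ∀ u, arU u ≤ m) (harV : ∀ v, arV v ≤ m)
    (eU : iE → iU) (eV : iE → iV)
    (ep : ∀ e : iE, Fin (arV (eV e)) → Fin (arU (eU e)))
    (hsat : ∃ (xiU : ∀ u : iU, (Fin (arU u) → A) → B)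
        (xiV : ∀ v : iV, (Fin (arV v) → A) → B),
      (∀ u, xiU u ∈ M.carrier (arU u)) ∧ (∀ v, xiV v ∈ M.carrier (arV v)) ∧
        ∀ (e : iE) (x : Fin (arU (eU e)) → A), xiU (eU e) x = xiV (eV e) (x ∘ ep e)) :
    ∃ (pU : ∀ u : iU, Fin (arU u)) (pV : ∀ v : iV, Fin (arV v)),
      Fintype.card iE ≤
        F * (Finset.univ.filter fun e : iE => ep e (pV (eV e)) = pU (eU e)).card := by
  classical
  obtain ⟨xiU, xiV, hU, hV, hid⟩ := hsat
  choose pU hpU using fun u => hess _ _ (hU u)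
  let S : ∀ v : iV, Fin (arV v) → Finset iE := fun v j => Finset.univ.filter fun e =>
    eV e = v ∧ ∃ j' : Fin (arV (eV e)), j'.val = j.val ∧ ep e j' = pU (eU e)
  have key : ∀ v : iV, ∃ j : Fin (arV v),
      (Finset.univ.filter fun e : iE => eV e = v).card ≤ F * (S v j).card := by
    intro v
    obtain ⟨j0, hj0⟩ := hess _ _ (hV v)
    let E : Finset (Fin (arV v)) := Finset.univ.filter fun j => EssentialCoord (xiV v) j
    have hE : E.Nonempty := ⟨j0, by simp [E, hj0]⟩
    have hEc : E.card ≤ F := by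
      have := hbound _ (harV v) _ (hV v)
      rwa [Nat.card_eq_fintype_card, Fintype.card_subtype] at this
    obtain ⟨j, hj, hmax⟩ := Finset.exists_max_image E (fun j => (S v j).card) hE
    refine ⟨j, ?_⟩
    have hsub : (Finset.univ.filter fun e : iE => eV e = v) ⊆ E.biUnion (S v) := by
      intro e he
      have hev : eV e = v := by simpa using he
      subst hev
      obtain ⟨j, hj, hji⟩ := exists_essential_preimage _ _ (ep e) (hid e) _ (hpU (eU e))
      exact Finset.mem_biUnion.2 ⟨j, by simp [E, hj],
        Finset.mem_filter.2 ⟨Finset.mem_univ _, rfl, j, rfl, hji⟩⟩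
    calc _ ≤ (E.biUnion (S v)).card := Finset.card_le_card hsub
      _ ≤ E.card * (S v j).card := Finset.card_biUnion_le_card_mul _ _ _ hmax
      _ ≤ _ := Nat.mul_le_mul_right _ hEc
  choose pV hpV using key
  refine ⟨pU, pV, ?_⟩
  rw [← Finset.card_univ, Finset.card_eq_sum_card_image eV Finset.univ,
    Finset.card_eq_sum_card_fiberwise (f := eV) (t := Finset.univ.image eV)
      (fun e _ => by simp), Finset.mul_sum]
  apply Finset.sum_le_sum
  intro v _
  refine (hpV v).trans (Nat.mul_le_mul_left _ (Finset.card_le_card ?_))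
  intro e he
  obtain ⟨-, hev, j', hj', hep⟩ := Finset.mem_filter.1 he
  subst hev
  have : j' = pV (eV e) := Fin.ext hj'
  subst this
  simp [hep]
end
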